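/- arXiv:math/0405092 — 3 statements merged into one kernel-verified Lean document; each statement's English description precedes it below -/
import Mathlib

section
/- For every d ≥ 1, the set {C ∈ 𝒦((2^ℕ)^d) : □(C)} is a Borel subset of the hyperspace 𝒦((2^ℕ)^d) of compact subsets of (2^ℕ)^d equipped with the Hausdorff metric. -/
open MeasureTheory Filter Set Topology
open scoped ENNReal

noncomputable section

/-- The Cantor space `2^ℕ`. -/
abbrev Cantor : Type := ℕ → Bool

/-- The uniform product ("fair coin-flipping") probability measure on `2^ℕ`, realized as the
pushforward of Lebesgue measure on `[0,1)` under the binary-digit map. -/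
noncomputable def cantorMeasure : Measure Cantor :=
  Measure.map (fun x : ℝ => fun n : ℕ => decide (⌊x * 2 ^ (n + 1)⌋ % 2 = 1))
    (volume.restrict (Set.Ico (0 : ℝ) 1))

/-- The basic cylinder `[a]` determined by a finite binary sequence `a`. -/
def cyl (a : List Bool) : Set Cantor := {x | ∀ i : Fin a.length, x i = a.get i}

/-- `[A] = ⋃ a ∈ A, [a]`. -/
def cylSet (A : Set (List Bool)) : Set Cantor := ⋃ a ∈ A, cyl a

/-- The weight `2^(-|a|·r)` of a node `a`. -/
noncomputable def wt (r : ℝ) (a : List Bool) : ℝ≥0∞ := (2 : ℝ≥0∞) ^ (-(a.length : ℝ) * r)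

/-- `Σ_{a ∈ A} 2^(-|a|·r)`. -/
noncomputable def wtSum (r : ℝ) (A : Set (List Bool)) : ℝ≥0∞ := ∑' a : A, wt r (a : List Bool)

/-- `A ∈ C^∞_ε`, i.e. `Σ_{a ∈ A} 2^(-|a|·r) ≤ ε`. -/
def memCinf (r ε : ℝ) (A : Set (List Bool)) : Prop := wtSum r A ≤ ENNReal.ofReal ε

/-- The `r`-dimensional dyadic Hausdorff capacity `λ^r_∞`. -/
noncomputable def hcap (r : ℝ) (X : Set Cantor) : ℝ≥0∞ :=
  ⨅ (A : Set (List Bool)) (_ : X ⊆ cylSet A), wtSum r A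

/-- `□_δ(X) = inf {λ^r_∞(X \ Z) : Z measurable, λ Z < δ}`. -/
noncomputable def sqcap (r δ : ℝ) (X : Set Cantor) : ℝ≥0∞ :=
  ⨅ (Z : Set Cantor) (_ : MeasurableSet Z) (_ : cantorMeasure Z < ENNReal.ofReal δ),
    hcap r (X \ Z)

/-- The relation `□_{Θ,Γ}(X)` for `X ⊆ (2^ℕ)^(d+1)` (the index `d` codes dimension `d+1`):
for dimension `1` it says `□_{Θ 0}(X) ≥ Γ 0`, and for dimension `n+2` it says
`□_{Θ (n+1)}({x : □_{Θ,Γ}(X(x,·))}) ≥ Γ (n+1)`, slicing along the first coordinate. -/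
def SqTG (r : ℝ) (Θ Γ : ℕ → ℝ) : (d : ℕ) → Set (Fin (d + 1) → Cantor) → Prop
  | 0, X => ENNReal.ofReal (Γ 0) ≤ sqcap r (Θ 0) {y : Cantor | (fun _ : Fin 1 => y) ∈ X}
  | (n + 1), X => ENNReal.ofReal (Γ (n + 1)) ≤
      sqcap r (Θ (n + 1))
        {x : Cantor | SqTG r Θ Γ n {y : Fin (n + 1) → Cantor | Fin.cons x y ∈ X}}

noncomputable instance : MetricSpace Cantor :=
  PiNat.metricSpaceOfDiscreteUniformity (E := fun _ : ℕ => Bool) fun _ => rfl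

theorem isOpen_cyl (a : List Bool) : IsOpen (cyl a) := by
  have h : cyl a = ⋂ i : Fin a.length, (fun x : Cantor => x i) ⁻¹' {a.get i} := by
    ext x
    simp [cyl]
  rw [h]
  exact isOpen_iInter_of_finite fun i =>
    (isOpen_discrete _).preimage (continuous_apply (i : ℕ))

theorem isOpen_cylSet (A : Set (List Bool)) : IsOpen (cylSet A) :=
  isOpen_biUnion fun a _ => isOpen_cyl a

theorem sqcap_mono (r δ : ℝ) {X Y : Set Cantor} (h : X ⊆ Y) : sqcap r δ X ≤ sqcap r δ Y :=
  iInf_mono fun _ => iInf₂_mono fun _ _ =>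
    le_iInf₂ fun A hA => iInf₂_le A ((sdiff_subset_sdiff_left h).trans hA)

instance : IsFiniteMeasure cantorMeasure := by
  unfold cantorMeasure
  infer_instance

/-- The relation `sqcap r δ X < γ` is witnessed on an open superset of `X`. -/
theorem exists_isOpen_sqcap_lt {r δ : ℝ} {γ : ℝ≥0∞} {X : Set Cantor} (h : sqcap r δ X < γ) :
    ∃ U, IsOpen U ∧ X ⊆ U ∧ sqcap r δ U < γ := by
  simp only [sqcap, hcap, iInf_lt_iff] at h
  obtain ⟨Z, -, hZδ, A, hXA, hA⟩ := h
  obtain ⟨O, hZO, hO, hOδ⟩ := Z.exists_isOpen_lt_of_lt _ hZδ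
  refine ⟨O ∪ cylSet A, hO.union (isOpen_cylSet A), ?_, ?_⟩
  · exact (sdiff_subset_iff.mp hXA).trans (union_subset_union_left _ hZO)
  · simp only [sqcap, hcap, iInf_lt_iff]
    exact ⟨O, hO.measurableSet, hOδ, A, sdiff_subset_iff.mpr Subset.rfl, hA⟩

theorem SqTG_mono (r : ℝ) (Θ Γ : ℕ → ℝ) :
    ∀ (d : ℕ) {X Y : Set (Fin (d + 1) → Cantor)}, X ⊆ Y → SqTG r Θ Γ d X → SqTG r Θ Γ d Y
  | 0, _, _, h => fun hX => hX.trans (sqcap_mono _ _ fun _ hy => h hy)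
  | n + 1, _, _, h => fun hX => hX.trans
      (sqcap_mono _ _ fun _ hx => SqTG_mono r Θ Γ n (fun _ hy => h hy) hx)

/-- If a closed set fails `SqTG`, then so does some open superset of it. -/
theorem exists_isOpen_not_SqTG (r : ℝ) (Θ Γ : ℕ → ℝ) (d : ℕ) {C : Set (Fin (d + 1) → Cantor)}
    (hC : IsClosed C) (h : ¬ SqTG r Θ Γ d C) :
    ∃ V, IsOpen V ∧ C ⊆ V ∧ ¬ SqTG r Θ Γ d V := by
  induction d with
  | zero =>
    simp only [SqTG, not_le] at h
    obtain ⟨U, hU, hCU, hUlt⟩ := exists_isOpen_sqcap_lt h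
    refine ⟨{x | x 0 ∈ U}, hU.preimage (continuous_apply 0), fun x hx => hCU ?_, ?_⟩
    · have hx' : (fun _ : Fin 1 => x 0) = x := by
        funext i
        rw [Subsingleton.elim i 0]
      simpa only [mem_ofPred_eq, hx'] using hx
    · simpa only [SqTG, not_le, mem_ofPred_eq, ofPred_mem_eq] using hUlt
  | succ n ih =>
    simp only [SqTG, not_le] at h
    obtain ⟨U, hU, hCU, hUlt⟩ := exists_isOpen_sqcap_lt h
    have hcons (x : Cantor) :
        Continuous fun y : Fin (n + 1) → Cantor => (Fin.cons x y : Fin (n + 2) → Cantor) :=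
      Continuous.finCons continuous_const continuous_id
    have hcons' : Continuous fun p : Cantor × (Fin (n + 1) → Cantor) =>
        (Fin.cons p.1 p.2 : Fin (n + 2) → Cantor) :=
      Continuous.finCons continuous_fst continuous_snd
    have hloc : ∀ x ∈ Uᶜ, ∃ V : Set (Fin (n + 1) → Cantor), ∃ F : Set Cantor,
        IsOpen V ∧ ¬ SqTG r Θ Γ n V ∧ IsClosed F ∧ F ∈ 𝓝 x ∧
          ∀ x' ∈ F, ∀ y, (Fin.cons x' y : Fin (n + 2) → Cantor) ∈ C → y ∈ V := by
      intro x hx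
      obtain ⟨V, hV, hxV, hVn⟩ := ih (hC.preimage (hcons x)) (fun hs => hx (hCU hs))
      have hS : IsClosed (Prod.fst '' {p : Cantor × (Fin (n + 1) → Cantor) |
          (Fin.cons p.1 p.2 : Fin (n + 2) → Cantor) ∈ C ∧ p.2 ∈ Vᶜ}) :=
        isClosedMap_fst_of_compactSpace _
          ((hC.preimage hcons').inter (hV.isClosed_compl.preimage continuous_snd))
      obtain ⟨F, hFx, hF, hFS⟩ := exists_mem_nhds_isClosed_subset (hS.isOpen_compl.mem_nhds
        (show x ∈ _ᶜ by
          rintro ⟨⟨x', y⟩, ⟨hp, hy⟩, rfl⟩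
          exact hy (hxV hp)))
      refine ⟨V, F, hV, hVn, hF, hFx, fun x' hx' y hy => ?_⟩
      by_contra hyV
      exact hFS hx' ⟨(x', y), ⟨hy, hyV⟩, rfl⟩
    choose! V F hV hVn hF hFx hFV using hloc
    obtain ⟨t, htU, ht⟩ :=
      hU.isClosed_compl.isCompact.elim_nhds_subcover F hFx
    have hTail : Continuous (Fin.tail : (Fin (n + 2) → Cantor) → Fin (n + 1) → Cantor) :=
      continuous_pi fun i => continuous_apply i.succ
    refine ⟨⋂ x ∈ t, {z | z 0 ∈ (F x)ᶜ ∨ Fin.tail z ∈ V x}, ?_, ?_, ?_⟩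
    · refine isOpen_biInter_finset fun x hx => ?_
      exact ((hF x (htU x hx)).isOpen_compl.preimage (continuous_apply 0)).union
        ((hV x (htU x hx)).preimage hTail)
    · refine fun z hz => mem_iInter₂.mpr fun x hx => or_iff_not_imp_left.mpr fun hzF => ?_
      refine hFV x (htU x hx) (z 0) (not_not.mp hzF) _ ?_
      rwa [Fin.cons_self_tail]
    · simp only [SqTG, not_le]
      refine (sqcap_mono _ _ fun x hx => ?_).trans_lt hUlt
      by_contra hxU
      obtain ⟨x₀, hx₀, hxF⟩ := mem_iUnion₂.mp (ht hxU)
      refine hVn x₀ (htU x₀ hx₀) (SqTG_mono r Θ Γ n (fun y hy => ?_) hx)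
      rcases mem_iInter₂.mp hy x₀ hx₀ with h' | h'
      · exact absurd hxF h'
      · simpa using h'

/-- here the dimension is `d + 1 ≥ 1`. -/
theorem statement9 (r : ℝ) (hr0 : 0 < r) (hr1 : r < 1)
    (Θ Γ : ℕ → ℝ) (hΘpos : ∀ i, 0 < Θ i) (hΓpos : ∀ i, 0 < Γ i)
    (hΘanti : StrictAnti Θ) (hΘlim : Filter.Tendsto Θ Filter.atTop (nhds 0))
    (hΘΓ : ∀ j, Θ j + Γ j < 1) (hΘΓsucc : ∀ j, Θ j + Γ (j + 1) < 1)
    (hΓdense : ∀ x ∈ Set.Ioo (0 : ℝ) 1, x ∈ closure (Set.range Γ))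
    (d : ℕ) :
    MeasurableSet[borel (TopologicalSpace.NonemptyCompacts (Fin (d + 1) → Cantor))]
      {C : TopologicalSpace.NonemptyCompacts (Fin (d + 1) → Cantor) |
        SqTG r Θ Γ d (C : Set (Fin (d + 1) → Cantor))} := by
  borelize (TopologicalSpace.NonemptyCompacts (Fin (d + 1) → Cantor))
  refine IsClosed.measurableSet ?_
  rw [← isOpen_compl_iff, isOpen_iff_forall_mem_open]
  intro C hC
  obtain ⟨V, hV, hCV, hVn⟩ := exists_isOpen_not_SqTG r Θ Γ d C.isCompact.isClosed hC
  exact ⟨{K | (K : Set (Fin (d + 1) → Cantor)) ⊆ V},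
    fun K hK hs => hVn (SqTG_mono r Θ Γ d hK hs),
    TopologicalSpace.NonemptyCompacts.isOpen_subsets_of_isOpen hV, hCV⟩
end
end

section
/- For every d ≥ 1, the set {C ∈ 𝒦((2^ℕ)^d) : □_*(C)} is a Borel subset of the hyperspace 𝒦((2^ℕ)^d) of compact subsets of (2^ℕ)^d equipped with the Hausdorff metric. -/
open MeasureTheory Filter Set Topology
open scoped ENNReal

noncomputable section

/-- The slice of a subset of a finite power at a fixed first coordinate. -/
def firstSlice {α : Type*} {n : ℕ} (X : Set (Fin (n + 1) → α)) (x : α) : Set (Fin n → α) :=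
  {y | (Fin.cons x y : Fin (n + 1) → α) ∈ X}

theorem hcap_mono (r : ℝ) {X Y : Set Cantor} (h : X ⊆ Y) : hcap r X ≤ hcap r Y :=
  le_iInf₂ fun A hA => iInf₂_le A (h.trans hA)

theorem sqcap_anti (r : ℝ) {δ ε : ℝ} (h : δ ≤ ε) (X : Set Cantor) :
    sqcap r ε X ≤ sqcap r δ X :=
  le_iInf fun Z => le_iInf₂ fun hZ hlt =>
    iInf_le_of_le Z <| iInf₂_le hZ (hlt.trans_le (ENNReal.ofReal_le_ofReal h))

theorem exists_isOpen_superset_sqcap_lt {r δ : ℝ} {γ : ℝ≥0∞} {X : Set Cantor}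
    (h : sqcap r δ X < γ) : ∃ W, IsOpen W ∧ X ⊆ W ∧ sqcap r δ W < γ := by
  simp only [sqcap, hcap, iInf_lt_iff] at h
  obtain ⟨Z, -, hZ, A, hA, hlt⟩ := h
  obtain ⟨U, hZU, hU, hUlt⟩ := Z.exists_isOpen_lt_of_lt _ hZ
  refine ⟨U ∪ cylSet A, hU.union (isOpen_cylSet A), fun x hx => ?_, ?_⟩
  · by_cases hxZ : x ∈ Z
    · exact Or.inl (hZU hxZ)
    · exact Or.inr (hA ⟨hx, hxZ⟩)
  · simp only [sqcap, hcap, iInf_lt_iff]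
    exact ⟨U, hU.measurableSet, hUlt, A, by rw [union_sdiff_left]; exact sdiff_subset, hlt⟩

theorem SqTG.mono {r : ℝ} {η Γ : ℕ → ℝ} {n : ℕ} {X Y : Set (Fin (n + 1) → Cantor)}
    (h : X ⊆ Y) (hX : SqTG r η Γ n X) : SqTG r η Γ n Y := by
  induction n with
  | zero => exact le_trans hX (sqcap_mono r _ fun _ hy => h hy)
  | succ n ih => exact le_trans hX (sqcap_mono r _ fun x hx => ih (fun _ hy => h hy) hx)

theorem SqTG.anti {r : ℝ} {η θ Γ : ℕ → ℝ} {n : ℕ} {X : Set (Fin (n + 1) → Cantor)}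
    (h : ∀ i ≤ n, θ i ≤ η i) (hX : SqTG r η Γ n X) : SqTG r θ Γ n X := by
  induction n with
  | zero => exact le_trans hX (sqcap_anti r (h 0 le_rfl) _)
  | succ n ih =>
    exact le_trans hX <| (sqcap_anti r (h _ le_rfl) _).trans <|
      sqcap_mono r _ fun x hx => ih (fun i hi => h i (hi.trans n.le_succ)) hx

theorem isOpen_setOf_firstSlice_subset {α : Type*} [TopologicalSpace α] [CompactSpace α]
    [T2Space α] {n : ℕ} {C : Set (Fin (n + 1) → α)} (hC : IsClosed C) {V : Set (Fin n → α)}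
    (hV : IsOpen V) : IsOpen {x | firstSlice C x ⊆ V} := by
  have htail : Continuous (Fin.tail : (Fin (n + 1) → α) → Fin n → α) :=
    continuous_pi fun i => continuous_apply i.succ
  have hK : IsCompact (C ∩ (Fin.tail ⁻¹' V)ᶜ) :=
    (hC.inter (hV.preimage htail).isClosed_compl).isCompact
  convert (hK.image (continuous_apply 0)).isClosed.isOpen_compl using 1
  ext x
  constructor
  · rintro hx ⟨z, ⟨hzC, hzV⟩, rfl⟩
    refine hzV (hx ?_)
    change Fin.cons (z 0) (Fin.tail z) ∈ C
    rwa [Fin.cons_self_tail]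
  · intro hx y hy
    by_contra hyV
    exact hx ⟨Fin.cons x y, ⟨hy, hyV⟩, rfl⟩

theorem exists_isOpen_superset_not_SqTG {r : ℝ} {η Γ : ℕ → ℝ} {n : ℕ}
    {C : Set (Fin (n + 1) → Cantor)} (hC : IsClosed C) (h : ¬ SqTG r η Γ n C) :
    ∃ V, IsOpen V ∧ C ⊆ V ∧ ¬ SqTG r η Γ n V := by
  induction n with
  | zero =>
    obtain ⟨W, hW, hCW, hlt⟩ := exists_isOpen_superset_sqcap_lt (not_le.1 h)
    refine ⟨{z | z 0 ∈ W}, hW.preimage (continuous_apply 0), fun z hz => hCW ?_, not_le.2 hlt⟩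
    change (fun _ => z 0) ∈ C
    convert hz with i
    exact Fin.fin_one_eq_zero i |>.symm
  | succ n ih =>
    obtain ⟨W, hW, hCW, hlt⟩ := exists_isOpen_superset_sqcap_lt (not_le.1 h)
    have hslice (x : Cantor) (hx : x ∈ Wᶜ) : ∃ V : Set (Fin (n + 1) → Cantor), ∃ N ∈ 𝓝 x,
        IsOpen V ∧ IsClosed N ∧ ¬ SqTG r η Γ n V ∧ ∀ y ∈ N, firstSlice C y ⊆ V := by
      have hcons : Continuous fun y : Fin (n + 1) → Cantor =>
          (Fin.cons x y : Fin (n + 2) → Cantor) := by fun_prop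
      obtain ⟨V, hV, hCV, hnV⟩ := ih (C := firstSlice C x) (hC.preimage hcons) fun hC => hx (hCW hC)
      obtain ⟨N, hN, hNc, hNV⟩ := exists_mem_nhds_isClosed_subset
        ((isOpen_setOf_firstSlice_subset hC hV).mem_nhds hCV)
      exact ⟨V, N, hN, hV, hNc, hnV, hNV⟩
    choose! V N hN hV hNc hnV hNV using hslice
    obtain ⟨t, htW, ht⟩ := hW.isClosed_compl.isCompact.elim_nhds_subcover N hN
    have htail : Continuous (Fin.tail : (Fin (n + 2) → Cantor) → Fin (n + 1) → Cantor) :=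
      continuous_pi fun i => continuous_apply i.succ
    refine ⟨⋂ i ∈ t, {z | z 0 ∈ (N i)ᶜ} ∪ Fin.tail ⁻¹' V i,
      isOpen_biInter_finset fun i hi => ?_, fun z hz => ?_, fun hS => ?_⟩
    · exact ((hNc i (htW i hi)).isOpen_compl.preimage (continuous_apply 0)).union
        ((hV i (htW i hi)).preimage htail)
    · refine mem_iInter₂.2 fun i hi => or_iff_not_imp_left.2 fun hzN => ?_
      refine hNV i (htW i hi) (z 0) (not_not.1 hzN) ?_
      change Fin.cons (z 0) (Fin.tail z) ∈ C
      rwa [Fin.cons_self_tail]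
    · refine hlt.not_ge (le_trans hS (sqcap_mono r _ fun x hx => ?_))
      by_contra hxW
      obtain ⟨i, hi, hxi⟩ := mem_iUnion₂.1 (ht hxW)
      refine hnV i (htW i hi) (SqTG.mono (fun y hy => ?_) hx)
      exact (mem_iInter₂.1 hy i hi).resolve_left (not_not.2 hxi)

theorem isClosed_setOf_SqTG (r : ℝ) (η Γ : ℕ → ℝ) (n : ℕ) :
    IsClosed {C : TopologicalSpace.NonemptyCompacts (Fin (n + 1) → Cantor) |
      SqTG r η Γ n (C : Set (Fin (n + 1) → Cantor))} := by
  rw [← isOpen_compl_iff, isOpen_iff_mem_nhds]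
  intro C hC
  obtain ⟨V, hV, hCV, hnV⟩ := exists_isOpen_superset_not_SqTG C.isCompact.isClosed hC
  filter_upwards [(TopologicalSpace.NonemptyCompacts.isOpen_subsets_of_isOpen hV).mem_nhds hCV]
    with D hD hS using hnV (SqTG.mono hD hS)

theorem exists_SqTG_iff {r : ℝ} {Γ : ℕ → ℝ} {n : ℕ} {X : Set (Fin (n + 1) → Cantor)} :
    (∃ η : ℕ → ℝ, (∀ i, 0 < η i) ∧ SqTG r η Γ n X) ↔
      ∃ k : ℕ, SqTG r (fun _ => 1 / ((k : ℝ) + 1)) Γ n X := by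
  constructor
  · rintro ⟨η, hη, hX⟩
    obtain ⟨i, -, hi⟩ := (Finset.range (n + 1)).exists_min_image η ⟨0, by simp⟩
    obtain ⟨k, hk⟩ := exists_nat_one_div_lt (hη i)
    exact ⟨k, hX.anti fun j hj => hk.le.trans (hi j (by simpa using Nat.lt_succ_of_le hj))⟩
  · rintro ⟨k, hk⟩
    exact ⟨_, fun _ => Nat.one_div_pos_of_nat, hk⟩

/-- here the dimension is `d + 1 ≥ 1`. -/
theorem statement10 (r : ℝ) (hr0 : 0 < r) (hr1 : r < 1)
    (Θ Γ : ℕ → ℝ) (hΘpos : ∀ i, 0 < Θ i) (hΓpos : ∀ i, 0 < Γ i)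
    (hΘanti : StrictAnti Θ) (hΘlim : Filter.Tendsto Θ Filter.atTop (nhds 0))
    (hΘΓ : ∀ j, Θ j + Γ j < 1) (hΘΓsucc : ∀ j, Θ j + Γ (j + 1) < 1)
    (hΓdense : ∀ x ∈ Set.Ioo (0 : ℝ) 1, x ∈ closure (Set.range Γ))
    (d : ℕ) :
    MeasurableSet[borel (TopologicalSpace.NonemptyCompacts (Fin (d + 1) → Cantor))]
      {C : TopologicalSpace.NonemptyCompacts (Fin (d + 1) → Cantor) |
        ∃ η : ℕ → ℝ, (∀ i, 0 < η i) ∧ SqTG r η Γ d (C : Set (Fin (d + 1) → Cantor))} := by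
  simp only [exists_SqTG_iff, ofPred_exists]
  let : MeasurableSpace (TopologicalSpace.NonemptyCompacts (Fin (d + 1) → Cantor)) := borel _
  have : BorelSpace (TopologicalSpace.NonemptyCompacts (Fin (d + 1) → Cantor)) := ⟨rfl⟩
  exact MeasurableSet.iUnion fun k => (isClosed_setOf_SqTG r _ Γ d).measurableSet
end
end

section
/- If {𝒜_n}_{n∈ℕ} is an increasing (under inclusion) sequence of finite subsets of C_∞, then ν^∞(⋃_{n∈ℕ} 𝒜_n) = lim_{n→∞} ν^∞(𝒜_n). -/
open MeasureTheory Filter Set Topology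
open scoped ENNReal

noncomputable section

/-- `□_{Θ,Γ}` reindexed by the true dimension `d ≥ 1`. -/
def SqDim (r : ℝ) (Θ Γ : ℕ → ℝ) : (d : ℕ) → Set (Fin d → Cantor) → Prop
  | 0, _ => False
  | (n + 1), X => SqTG r Θ Γ n X

/-- `□_*(X)` : `□_{η,Γ}(X)` holds for some `η : ℕ → ℝ⁺`. -/
def SqStarDim (r : ℝ) (Γ : ℕ → ℝ) (d : ℕ) (X : Set (Fin d → Cantor)) : Prop :=
  ∃ η : ℕ → ℝ, (∀ i, 0 < η i) ∧ SqDim r η Γ d X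

/-- `⟨z,F⟩ = {w ∈ 𝒳 : z ∉ [F w]}`. -/
def angbr (z : Cantor) (F : Set (List Bool) → Set (List Bool))
    (𝒳 : Set (Set (List Bool))) : Set (Set (List Bool)) := {w ∈ 𝒳 | z ∉ cylSet (F w)}

/-- `ρ*(𝒳)`: the set of `d > 1` such that for every compact `C ⊆ (2^ℕ)^d` with `□(C)` and every
continuous `F : C → 2^ℕ` there is `x ∈ 𝒳` with `□_*(F⁻¹[x])`. -/
def rhoStar (r : ℝ) (Θ Γ : ℕ → ℝ) (𝒳 : Set (Set (List Bool))) : Set ℕ :=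
  {d : ℕ | 1 < d ∧ ∀ C : Set (Fin d → Cantor), IsCompact C → SqDim r Θ Γ d C →
    ∀ F : (Fin d → Cantor) → Cantor, ContinuousOn F C →
      ∃ x ∈ 𝒳, SqStarDim r Γ d (C ∩ F ⁻¹' cylSet x)}

/-- `ρ(𝒳) = sup ρ*(𝒳)` (with `sup ∅ = 0`). -/
noncomputable def rho (r : ℝ) (Θ Γ : ℕ → ℝ) (𝒳 : Set (Set (List Bool))) : ℕ∞ :=
  sSup ((fun d : ℕ => (d : ℕ∞)) '' rhoStar r Θ Γ 𝒳)

/-- The sets `𝒩_j` (with finite-set-valued test functions `F`). -/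
def Nrec (r : ℝ) (Θ Γ : ℕ → ℝ) : ℕ → Set (Set (Set (List Bool)))
  | 0 => {𝒳 | 𝒳.Nonempty}
  | 1 => {𝒳 | cylSet (⋃₀ 𝒳) = Set.univ}
  | (k + 2) => {𝒳 | ∀ F : Set (List Bool) → Set (List Bool),
      (∀ a ∈ 𝒳, (F a).Finite ∧ memCinf r (Γ (k + 1) / 2) (F a)) →
      sqcap r (Θ k) {z : Cantor | angbr z F 𝒳 ∉ Nrec r Θ Γ (k + 1)} <
        ENNReal.ofReal (Γ (k + 1))}

/-- The sets `𝒩^∞_j` (with `C^∞`-valued test functions `F`). -/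
def NrecInf (r : ℝ) (Θ Γ : ℕ → ℝ) : ℕ → Set (Set (Set (List Bool)))
  | 0 => {𝒳 | 𝒳.Nonempty}
  | 1 => {𝒳 | cylSet (⋃₀ 𝒳) = Set.univ}
  | (k + 2) => {𝒳 | ∀ F : Set (List Bool) → Set (List Bool),
      (∀ a ∈ 𝒳, memCinf r (Γ (k + 1) / 2) (F a)) →
      sqcap r (Θ k) {z : Cantor | angbr z F 𝒳 ∉ NrecInf r Θ Γ (k + 1)} <
        ENNReal.ofReal (Γ (k + 1))}

/-- `ν(𝒳) = sup {j : 𝒳 ∈ 𝒩_j}`. -/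
noncomputable def nu (r : ℝ) (Θ Γ : ℕ → ℝ) (𝒳 : Set (Set (List Bool))) : ℕ∞ :=
  sSup ((fun j : ℕ => (j : ℕ∞)) '' {j | 𝒳 ∈ Nrec r Θ Γ j})

/-- `ν^∞(𝒳) = sup {j : 𝒳 ∈ 𝒩^∞_j}`. -/
noncomputable def nuInf (r : ℝ) (Θ Γ : ℕ → ℝ) (𝒳 : Set (Set (List Bool))) : ℕ∞ :=
  sSup ((fun j : ℕ => (j : ℕ∞)) '' {j | 𝒳 ∈ NrecInf r Θ Γ j})

theorem measurableSet_cyl (a : List Bool) : MeasurableSet (cyl a) := by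
  have : cyl a = ⋂ i : Fin a.length, (fun x : Cantor => x i) ⁻¹' {a.get i} := by
    ext x; simp [cyl]
  rw [this]
  exact MeasurableSet.iInter fun i => measurable_pi_apply _ (MeasurableSet.singleton _)

theorem measurableSet_cylSet (A : Set (List Bool)) : MeasurableSet (cylSet A) :=
  MeasurableSet.biUnion A.to_countable fun a _ => measurableSet_cyl a

theorem cylSet_mono {A B : Set (List Bool)} (h : A ⊆ B) : cylSet A ⊆ cylSet B :=
  biUnion_subset_biUnion_left h

instance isFiniteMeasure_cantorMeasure : IsFiniteMeasure cantorMeasure := by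
  unfold cantorMeasure; infer_instance

/-- The integer part of `x * 2 ^ n` is determined by that of `x` and the first `n` binary digits
of `x`. -/
theorem floor_mul_two_pow_eq {x y : ℝ} (h0 : ⌊x⌋ = ⌊y⌋) (n : ℕ)
    (h : ∀ i < n, (⌊x * 2 ^ (i + 1)⌋ % 2 = 1 ↔ ⌊y * 2 ^ (i + 1)⌋ % 2 = 1)) :
    ⌊x * 2 ^ n⌋ = ⌊y * 2 ^ n⌋ := by
  induction n with
  | zero => simpa using h0
  | succ n ih =>
    have key (t : ℝ) : ⌊t * 2 ^ (n + 1)⌋ / 2 = ⌊t * 2 ^ n⌋ := by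
      have : t * 2 ^ n = t * 2 ^ (n + 1) / ((2 : ℕ) : ℝ) := by push_cast; ring
      rw [this, Int.floor_div_natCast]; rfl
    have h1 := ih fun i hi => h i (hi.trans n.lt_succ_self)
    have h2 := h n n.lt_succ_self
    rw [← key x, ← key y] at h1
    omega

theorem cantorMeasure_cyl_le (a : List Bool) :
    cantorMeasure (cyl a) ≤ (2 : ℝ≥0∞) ^ (-(a.length : ℝ)) := by
  have hm : Measurable (fun x : ℝ => fun n : ℕ => decide (⌊x * 2 ^ (n + 1)⌋ % 2 = 1)) := by
    refine measurable_pi_lambda _ fun n => ?_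
    have : Measurable fun x : ℝ => ⌊x * 2 ^ (n + 1)⌋ :=
      Int.measurable_floor.comp (measurable_id.mul_const _)
    exact (measurable_from_top (f := fun k : ℤ => decide (k % 2 = 1))).comp this
  unfold cantorMeasure
  rw [Measure.map_apply hm (measurableSet_cyl a),
    Measure.restrict_apply (hm (measurableSet_cyl a))]
  set S := (fun x : ℝ => fun n : ℕ => decide (⌊x * 2 ^ (n + 1)⌋ % 2 = 1)) ⁻¹' cyl a ∩ Ico 0 1
  rcases S.eq_empty_or_nonempty with he | ⟨y, hy⟩
  · simp [he]
  set k : ℤ := ⌊y * 2 ^ a.length⌋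
  have hsub : S ⊆ Ico ((k : ℝ) / 2 ^ a.length) ((k + 1) / 2 ^ a.length) := by
    intro x hx
    have hfl : ⌊x * 2 ^ a.length⌋ = k := by
      refine floor_mul_two_pow_eq ?_ _ fun i hi => ?_
      · rw [Int.floor_eq_zero_iff.2 hx.2, Int.floor_eq_zero_iff.2 hy.2]
      · have h1 := hx.1 ⟨i, hi⟩
        have h2 := hy.1 ⟨i, hi⟩
        exact decide_eq_decide.1 (h1.trans h2.symm)
    rw [Int.floor_eq_iff] at hfl
    have h2 : (0 : ℝ) < 2 ^ a.length := by positivity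
    exact ⟨(div_le_iff₀ h2).2 hfl.1, (lt_div_iff₀ h2).2 hfl.2⟩
  refine (measure_mono hsub).trans (le_of_eq ?_)
  rw [Real.volume_Ico, ← sub_div, add_sub_cancel_left, one_div, ENNReal.rpow_neg,
    ENNReal.rpow_natCast, ENNReal.ofReal_inv_of_pos (by positivity),
    ENNReal.ofReal_pow (by norm_num), ENNReal.ofReal_ofNat]

theorem cantorMeasure_cylSet_le {r : ℝ} (hr1 : r < 1) (L : ℕ) (A : Set (List Bool))
    (hA : ∀ a ∈ A, L ≤ a.length) :
    cantorMeasure (cylSet A) ≤ ((2 : ℝ≥0∞) ^ (-(1 - r))) ^ L * wtSum r A := by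
  rw [wtSum, ← ENNReal.tsum_mul_left]
  refine (measure_biUnion_le _ A.to_countable _).trans (ENNReal.tsum_le_tsum fun a => ?_)
  refine (cantorMeasure_cyl_le a).trans ?_
  rw [wt, ← ENNReal.rpow_natCast, ← ENNReal.rpow_mul,
    ← ENNReal.rpow_add _ _ (by norm_num) (by norm_num)]
  refine ENNReal.rpow_le_rpow_of_exponent_le (by norm_num) ?_
  have : (L : ℝ) ≤ (a : List Bool).length := by exact_mod_cast hA a a.2
  nlinarith

theorem tendsto_two_rpow_pow_zero {r : ℝ} (hr1 : r < 1) :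
    Tendsto (fun L : ℕ => ((2 : ℝ≥0∞) ^ (-(1 - r))) ^ L) atTop (𝓝 0) := by
  refine ENNReal.tendsto_pow_atTop_nhds_zero_of_lt_one ?_
  exact ENNReal.rpow_lt_one_of_one_lt_of_neg (by norm_num) (by linarith)

theorem sqcap_lt_iff {r δ : ℝ} {X : Set Cantor} {c : ℝ≥0∞} :
    sqcap r δ X < c ↔ ∃ Z A, MeasurableSet Z ∧ cantorMeasure Z < ENNReal.ofReal δ ∧
      X \ Z ⊆ cylSet A ∧ wtSum r A < c := by
  simp only [sqcap, hcap, iInf_lt_iff]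
  constructor
  · rintro ⟨Z, h1, h2, A, h3, h4⟩; exact ⟨Z, A, h1, h2, h3, h4⟩
  · rintro ⟨Z, A, h1, h2, h3, h4⟩; exact ⟨Z, h1, h2, A, h3, h4⟩

theorem sqcap_lt_mono {r δ : ℝ} {X Y : Set Cantor} {c : ℝ≥0∞} (h : X ⊆ Y)
    (hY : sqcap r δ Y < c) : sqcap r δ X < c := by
  obtain ⟨Z, A, h1, h2, h3, h4⟩ := sqcap_lt_iff.1 hY
  exact sqcap_lt_iff.2 ⟨Z, A, h1, h2, (sdiff_subset_sdiff_left h).trans h3, h4⟩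

theorem wtSum_le_of_finset {r : ℝ} {A : Set (List Bool)} {c : ℝ≥0∞}
    (h : ∀ s : Finset (List Bool), ↑s ⊆ A → ∑ a ∈ s, wt r a ≤ c) : wtSum r A ≤ c := by
  rw [wtSum, ENNReal.tsum_eq_iSup_sum]
  refine iSup_le fun s => ?_
  have := h (s.map (Function.Embedding.subtype _)) (by intro x; simp; tauto)
  simpa using this

theorem sum_wt_le_wtSum {r : ℝ} {A : Set (List Bool)} {s : Finset (List Bool)} (h : ↑s ⊆ A) :
    ∑ a ∈ s, wt r a ≤ wtSum r A := by
  rw [← Finset.tsum_subtype]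
  exact ENNReal.tsum_mono_subtype _ h

theorem wtSum_mono {r : ℝ} {A B : Set (List Bool)} (h : A ⊆ B) : wtSum r A ≤ wtSum r B :=
  ENNReal.tsum_mono_subtype _ h

theorem angbr_mono {𝒳 𝒴 : Set (Set (List Bool))} (h : 𝒳 ⊆ 𝒴) (z : Cantor)
    (F : Set (List Bool) → Set (List Bool)) : angbr z F 𝒳 ⊆ angbr z F 𝒴 :=
  fun _ hw => ⟨h hw.1, hw.2⟩

theorem NrecInf_mono (r : ℝ) (Θ Γ : ℕ → ℝ) (j : ℕ) {𝒳 𝒴 : Set (Set (List Bool))} (h : 𝒳 ⊆ 𝒴)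
    (h𝒳 : 𝒳 ∈ NrecInf r Θ Γ j) : 𝒴 ∈ NrecInf r Θ Γ j := by
  induction j generalizing 𝒳 𝒴 with
  | zero => exact Set.Nonempty.mono h h𝒳
  | succ j ih =>
    cases j with
    | zero => exact univ_subset_iff.1 (h𝒳.symm.subset.trans (cylSet_mono (sUnion_mono h)))
    | succ k =>
      intro F hF
      exact sqcap_lt_mono (fun z hz hmem => hz (ih (angbr_mono h z F) hmem))
        (h𝒳 F fun a ha => hF a (h ha))

/-- The property `⟨z, F⟩ ∈ P` depends on `z` only through finitely many membership conditions
`z ∈ [F w]`, so it is measurable in `z`. -/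
theorem measurableSet_angbr_mem {𝒳 : Set (Set (List Bool))} (h𝒳 : 𝒳.Finite)
    (F : Set (List Bool) → Set (List Bool)) (P : Set (Set (Set (List Bool)))) :
    MeasurableSet {z | angbr z F 𝒳 ∈ P} := by
  have hfib (T : Set (Set (List Bool))) : MeasurableSet {z | angbr z F 𝒳 = T} := by
    have : {z | angbr z F 𝒳 = T} = {_z : Cantor | T ⊆ 𝒳} ∩
        ⋂ w ∈ 𝒳, {z | z ∉ cylSet (F w) ↔ w ∈ T} := by
      ext z
      simp only [angbr, mem_ofPred_eq, mem_inter_iff, mem_iInter, Set.ext_iff, Set.subset_def]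
      constructor
      · exact fun h => ⟨fun w hw => ((h w).2 hw).1,
          fun w hw => ⟨fun hz => (h w).1 ⟨hw, hz⟩, fun hT => ((h w).2 hT).2⟩⟩
      · exact fun h w => ⟨fun hw => (h.2 w hw.1).1 hw.2,
          fun hT => ⟨h.1 w hT, (h.2 w (h.1 w hT)).2 hT⟩⟩
    rw [this]
    refine (MeasurableSet.const _).inter (MeasurableSet.biInter h𝒳.countable fun w _ => ?_)
    by_cases hw : w ∈ T
    · simp only [hw, iff_true]
      exact (measurableSet_cylSet (F w)).compl
    · simp only [hw, iff_false, not_not]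
      exact measurableSet_cylSet (F w)
  have : {z | angbr z F 𝒳 ∈ P} = ⋃ T ∈ 𝒳.powerset ∩ P, {z | angbr z F 𝒳 = T} := by
    ext z
    simp only [mem_ofPred_eq, mem_iUnion, exists_prop, exists_eq_right', mem_inter_iff,
      mem_powerset_iff]
    exact ⟨fun h => ⟨fun w hw => hw.1, h⟩, fun h => h.2⟩
  rw [this]
  exact MeasurableSet.biUnion (h𝒳.powerset.inter_of_left P).countable fun T _ => hfib T

theorem exists_cylSet_sUnion_eq_univ {𝒜 : ℕ → Set (Set (List Bool))} (hmono : Monotone 𝒜)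
    (h : cylSet (⋃₀ ⋃ n, 𝒜 n) = univ) : ∃ n, cylSet (⋃₀ 𝒜 n) = univ := by
  have hcov : (univ : Set Cantor) ⊆ ⋃ n, cylSet (⋃₀ 𝒜 n) := by
    rw [← h]
    intro x hx
    simp only [cylSet, mem_iUnion, mem_sUnion] at hx ⊢
    obtain ⟨a, ⟨w, ⟨n, hn⟩, haw⟩, hxa⟩ := hx
    exact ⟨n, a, ⟨w, hn, haw⟩, hxa⟩
  obtain ⟨n, hn⟩ := isCompact_univ.elim_directed_cover _
    (fun n => isOpen_biUnion fun a _ => isOpen_cyl a) hcov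
    (Monotone.directed_le fun m n hmn => cylSet_mono (sUnion_mono (hmono hmn)))
  exact ⟨n, univ_subset_iff.1 hn⟩

/-- The limit of a sequence of set-valued functions along an ultrafilter. -/
def ultraLimit (U : Ultrafilter ℕ) (F : ℕ → Set (List Bool) → Set (List Bool))
    (w : Set (List Bool)) : Set (List Bool) := {a | ∀ᶠ n in U, a ∈ F n w}

theorem wtSum_ultraLimit_le {r : ℝ} {U : Ultrafilter ℕ}
    {F : ℕ → Set (List Bool) → Set (List Bool)} {w : Set (List Bool)} {c : ℝ≥0∞}
    (h : ∀ᶠ n in U, wtSum r (F n w) ≤ c) : wtSum r (ultraLimit U F w) ≤ c := by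
  refine wtSum_le_of_finset fun s hs => ?_
  have h1 : ∀ᶠ n in U, ∀ a ∈ s, a ∈ F n w := (Filter.eventually_all_finset s).2 fun a ha => hs ha
  obtain ⟨n, hn1, hn2⟩ := (h1.and h).exists
  exact (sum_wt_le_wtSum hn1).trans hn2

/-- For almost every `n`, off a set of small measure, each `w` in the finite set `𝒳` with
`z ∉ [ultraLimit U F w]` satisfies `z ∉ [F n w]`: the part of `F n w` outside the limit consists
of long sequences, and covers a set of small measure because `r < 1`. -/
theorem eventually_exists_small_exception {r : ℝ} (hr1 : r < 1) {U : Ultrafilter ℕ}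
    {F : ℕ → Set (List Bool) → Set (List Bool)} {𝒳 : Set (Set (List Bool))} (h𝒳 : 𝒳.Finite)
    {c : ℝ≥0∞} (hc : c ≠ ∞) (h : ∀ᶠ n in U, ∀ w ∈ 𝒳, wtSum r (F n w) ≤ c)
    {ε : ℝ≥0∞} (hε : 0 < ε) :
    ∀ᶠ n in U, ∃ Y, MeasurableSet Y ∧ cantorMeasure Y < ε ∧
      ∀ z ∉ Y, angbr z (ultraLimit U F) 𝒳 ⊆ angbr z (F n) 𝒳 := by
  have hlim : Tendsto (fun L : ℕ => h𝒳.toFinset.card * (((2 : ℝ≥0∞) ^ (-(1 - r))) ^ L * c))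
      atTop (𝓝 0) := by
    have h1 := ENNReal.Tendsto.mul_const (tendsto_two_rpow_pow_zero hr1) (Or.inr hc)
    have h2 := ENNReal.Tendsto.const_mul h1
      (Or.inr (ENNReal.natCast_ne_top h𝒳.toFinset.card))
    simpa using h2
  obtain ⟨L, hL⟩ := (hlim.eventually_lt_const hε).exists
  have hagree : ∀ᶠ n in U, ∀ w ∈ 𝒳, ∀ a ∈ {a : List Bool | a.length ≤ L},
      a ∈ F n w → a ∈ ultraLimit U F w := by
    refine (Filter.eventually_all_finite h𝒳).2 fun w _ =>
      (Filter.eventually_all_finite (List.finite_length_le Bool L)).2 fun a _ => ?_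
    by_cases ha : a ∈ ultraLimit U F w
    · exact Eventually.of_forall fun _ _ => ha
    · filter_upwards [Ultrafilter.eventually_not.2 ha] with n hn h'
      exact absurd h' hn
  filter_upwards [h, hagree] with n hn1 hn2
  refine ⟨⋃ w ∈ 𝒳, cylSet {a ∈ F n w | L ≤ a.length},
    MeasurableSet.biUnion h𝒳.countable fun w _ => measurableSet_cylSet _, ?_, ?_⟩
  · have heq : (⋃ w ∈ 𝒳, cylSet {a ∈ F n w | L ≤ a.length}) =
        ⋃ w ∈ h𝒳.toFinset, cylSet {a ∈ F n w | L ≤ a.length} := by simp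
    rw [heq]
    refine (measure_biUnion_finset_le _ _).trans_lt (lt_of_le_of_lt ?_ hL)
    rw [← nsmul_eq_mul]
    refine Finset.sum_le_card_nsmul _ _ _ fun w hw => ?_
    refine (cantorMeasure_cylSet_le hr1 L _ fun a ha => ha.2).trans ?_
    gcongr
    exact (wtSum_mono fun a ha => ha.1).trans (hn1 w (h𝒳.mem_toFinset.1 hw))
  · rintro z hz w ⟨hw, hzw⟩
    refine ⟨hw, fun hz' => ?_⟩
    simp only [cylSet, mem_iUnion, exists_prop, not_exists, not_and, mem_ofPred_eq] at hz hzw hz'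
    obtain ⟨a, ha, hza⟩ := hz'
    rcases le_total a.length L with hl | hl
    · exact hzw a (hn2 w hw a hl ha) hza
    · exact hz w hw a ⟨ha, hl⟩ hza

theorem exists_mem_NrecInf {r : ℝ} (hr1 : r < 1) (Θ Γ : ℕ → ℝ) (j : ℕ)
    {𝒜 : ℕ → Set (Set (List Bool))} (hmono : Monotone 𝒜) (hfin : ∀ n, (𝒜 n).Finite)
    (h : (⋃ n, 𝒜 n) ∈ NrecInf r Θ Γ j) : ∃ n, 𝒜 n ∈ NrecInf r Θ Γ j := by
  induction j generalizing 𝒜 with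
  | zero =>
    obtain ⟨w, hw⟩ := h
    obtain ⟨n, hn⟩ := mem_iUnion.1 hw
    exact ⟨n, w, hn⟩
  | succ j ih =>
    cases j with
    | zero => exact exists_cylSet_sUnion_eq_univ hmono h
    | succ k =>
      by_contra! hcon
      simp only [NrecInf, mem_ofPred_eq, not_forall, exists_prop] at hcon
      choose F hF hFcap using hcon
      let U : Ultrafilter ℕ := hyperfilter ℕ
      have hU : (U : Filter ℕ) ≤ atTop := Nat.hyperfilter_le_atTop
      set G := ultraLimit U F
      have hbound (m : ℕ) :
          ∀ᶠ n in U, ∀ w ∈ 𝒜 m, wtSum r (F n w) ≤ ENNReal.ofReal (Γ (k + 1) / 2) := by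
        filter_upwards [hU (eventually_ge_atTop m)] with n hn w hw using hF n w (hmono hn hw)
      have hGmem : ∀ w ∈ ⋃ n, 𝒜 n, memCinf r (Γ (k + 1) / 2) (G w) := by
        intro w hw
        obtain ⟨m, hm⟩ := mem_iUnion.1 hw
        exact wtSum_ultraLimit_le ((hbound m).mono fun n hn => hn w hm)
      obtain ⟨Z, A, hZ, hZlt, hZA, hA⟩ := sqcap_lt_iff.1 (h G hGmem)
      let D : ℕ → Set Cantor := fun m => {z | angbr z G (𝒜 m) ∉ NrecInf r Θ Γ (k + 1)}
      have hD (m : ℕ) : MeasurableSet (D m) :=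
        measurableSet_angbr_mem (hfin m) G (NrecInf r Θ Γ (k + 1))ᶜ
      have hDanti : Antitone D := fun m n hmn z hz hz' =>
        hz (NrecInf_mono r Θ Γ _ (angbr_mono (hmono hmn) z G) hz')
      let E : ℕ → Set Cantor := fun m => (D m \ Z) \ cylSet A
      have hE (m : ℕ) : MeasurableSet (E m) :=
        ((hD m).diff hZ).diff (measurableSet_cylSet A)
      have hEempty : ⋂ m, E m = ∅ := by
        refine eq_empty_of_forall_notMem fun z hz => ?_
        rw [mem_iInter] at hz
        refine (hz 0).2 (hZA ⟨fun hmem => ?_, (hz 0).1.2⟩)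
        have hun : angbr z G (⋃ n, 𝒜 n) = ⋃ n, angbr z G (𝒜 n) := by
          ext w; simp [angbr]
        rw [hun] at hmem
        obtain ⟨m, hm⟩ := ih (fun m n hmn => angbr_mono (hmono hmn) z G)
          (fun n => (hfin n).subset fun w hw => hw.1) hmem
        exact (hz m).1.1 hm
      have hElim : Tendsto (fun m => cantorMeasure (E m)) atTop (𝓝 0) := by
        have := tendsto_measure_iInter_atTop (μ := cantorMeasure)
          (fun m => (hE m).nullMeasurableSet)
          (fun m n hmn => sdiff_subset_sdiff_left (sdiff_subset_sdiff_left (hDanti hmn)))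
          ⟨0, measure_ne_top _ _⟩
        rwa [hEempty, measure_empty] at this
      obtain ⟨ε, hε, hεlt⟩ : ∃ ε : ℝ≥0∞, 0 < ε ∧
          cantorMeasure Z + (ε + ε) < ENNReal.ofReal (Θ k) := by
        have hpos : 0 < ENNReal.ofReal (Θ k) - cantorMeasure Z := tsub_pos_of_lt hZlt
        obtain ⟨d, hd0, hd⟩ := exists_between hpos
        refine ⟨d / 2, ENNReal.half_pos hd0.ne', ?_⟩
        rw [ENNReal.add_halves, add_comm]
        exact lt_tsub_iff_right.1 hd
      obtain ⟨m, hm⟩ := (hElim.eventually_lt_const hε).exists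
      obtain ⟨n, ⟨Y, hY, hYlt, hYsub⟩, hmn⟩ :=
        ((eventually_exists_small_exception hr1 (hfin m) ENNReal.ofReal_ne_top (hbound m)
          hε).and (hU (eventually_ge_atTop m))).exists
      refine hFcap n (sqcap_lt_iff.2 ⟨Z ∪ (E m ∪ Y), A, hZ.union ((hE m).union hY), ?_, ?_, hA⟩)
      · refine lt_of_le_of_lt ?_ hεlt
        refine (measure_union_le _ _).trans (add_le_add_right ?_ _)
        exact (measure_union_le _ _).trans (add_le_add hm.le hYlt.le)
      · rintro z ⟨hz, hzn⟩
        simp only [mem_union, not_or] at hzn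
        by_contra hzA
        refine hzn.2.1 ⟨⟨fun hzG => hz ?_, hzn.1⟩, hzA⟩
        exact NrecInf_mono r Θ Γ _
          ((hYsub z hzn.2.2).trans (angbr_mono (hmono hmn) z (F n))) hzG

theorem nuInf_mono (r : ℝ) (Θ Γ : ℕ → ℝ) {𝒳 𝒴 : Set (Set (List Bool))} (h : 𝒳 ⊆ 𝒴) :
    nuInf r Θ Γ 𝒳 ≤ nuInf r Θ Γ 𝒴 :=
  sSup_le_sSup (image_mono fun j hj => NrecInf_mono r Θ Γ j h hj)

theorem statement15 (r : ℝ) (hr0 : 0 < r) (hr1 : r < 1)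
    (Θ Γ : ℕ → ℝ) (hΘpos : ∀ i, 0 < Θ i) (hΓpos : ∀ i, 0 < Γ i)
    (hΘanti : StrictAnti Θ) (hΘlim : Filter.Tendsto Θ Filter.atTop (nhds 0))
    (hΘΓ : ∀ j, Θ j + Γ j < 1) (hΘΓsucc : ∀ j, Θ j + Γ (j + 1) < 1)
    (hΓdense : ∀ x ∈ Set.Ioo (0 : ℝ) 1, x ∈ closure (Set.range Γ))
    (𝒜 : ℕ → Set (Set (List Bool))) (hmono : Monotone 𝒜)
    (hfin : ∀ n, (𝒜 n).Finite) (hmem : ∀ n, ∀ a ∈ 𝒜 n, a.Finite) :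
    Filter.Tendsto (fun n => nuInf r Θ Γ (𝒜 n)) Filter.atTop
      (nhds (nuInf r Θ Γ (⋃ n, 𝒜 n))) := by
  have hmono' : Monotone fun n => nuInf r Θ Γ (𝒜 n) :=
    fun m n hmn => nuInf_mono r Θ Γ (hmono hmn)
  have heq : nuInf r Θ Γ (⋃ n, 𝒜 n) = ⨆ n, nuInf r Θ Γ (𝒜 n) := by
    refine le_antisymm (sSup_le ?_) (iSup_le fun n => nuInf_mono r Θ Γ (subset_iUnion 𝒜 n))
    rintro _ ⟨j, hj, rfl⟩
    obtain ⟨n, hn⟩ := exists_mem_NrecInf hr1 Θ Γ j hmono hfin hj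
    have hj' : j ∈ {j | 𝒜 n ∈ NrecInf r Θ Γ j} := hn
    exact (le_sSup (mem_image_of_mem _ hj')).trans
      (le_iSup (fun n => nuInf r Θ Γ (𝒜 n)) n)
  rw [heq]
  exact tendsto_atTop_iSup hmono'
end
end
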